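/- Let 0 < c ≤ 1, set γ = c/4, and let 𝓔 ⊆ T_n(2) with |𝓔| ≥ c·n³. For 1 ≤ k ≤ n let E_k' = {(i,j) ∈ [n]² : [a_k,b_i,c_j] ∈ 𝓔}, and let E_k ⊆ E_k' be obtained by replacing each row J'_{ki} = {j : (i,j) ∈ E_k'} with an arbitrary subset J_{ki} ⊆ J'_{ki} of size min{⌊n/2⌋, |J'_{ki}|} (so that each row of E_k has size at most n/2 and |E_k| ≥ |E_k'|/2). Then for every Latin square L = (π_1,…,π_n) of order n with f_𝓔(L) < 10^{-3}·c²·n², there exists a subset I_L ⊆ [n] of size at least γn/2 such that for every i ∈ I_L both |E_i| ≥ γ·n² and g_{E_i}(π_i) ≤ γn/10. -/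

import Mathlib

open Finset
open scoped Classical

noncomputable section

/-- A Latin square of order `n`: an `n`-tuple `(π_1,…,π_n)` of permutations of `[n]`
such that `π_i ∘ π_j⁻¹` is fixed-point-free for all `i ≠ j`. -/
def IsLatinSquare {n : ℕ} (L : Fin n → Equiv.Perm (Fin n)) : Prop :=
  ∀ i j : Fin n, i ≠ j → ∀ x : Fin n, L i x ≠ L j x

/-- The (finite) space of Latin squares of order `n`. -/
abbrev LatinSquare (n : ℕ) := {L : Fin n → Equiv.Perm (Fin n) // IsLatinSquare L}

/-- For a family `𝓔` of `2`-simplices of `T_n` (encoded as triples of indices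
`(i,j,k)` standing for `[a_i, b_j, c_k]`), `f_𝓔(L) = |Y(L)(2) ∩ 𝓔|` is the number of
`2`-simplices `[a_i, b_j, c_{π_i(j)}]` of `Y(L)` lying in `𝓔`. -/
def fE {n : ℕ} (E : Finset (Fin n × Fin n × Fin n)) (L : LatinSquare n) : ℕ :=
  (univ.filter fun p : Fin n × Fin n => (p.1, p.2, (L.1 p.1) p.2) ∈ E).card

/-- For `E ⊆ [n]²` and a permutation `π` of `[n]`,
`g_E(π) = |{i ∈ [n] : (i, π(i)) ∈ E}|`. -/
def gE {n : ℕ} (E : Finset (Fin n × Fin n)) (π : Equiv.Perm (Fin n)) : ℕ :=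
  (univ.filter fun i : Fin n => (i, π i) ∈ E).card

theorem aux_card_rows {n : ℕ} (S : Finset (Fin n × Fin n)) :
    S.card = ∑ i : Fin n, (S.filter fun p => p.1 = i).card :=
  Finset.card_eq_sum_card_fiberwise (fun _ _ => Finset.mem_coe.2 (Finset.mem_univ _))

theorem aux_card_triples {n : ℕ} (S : Finset (Fin n × Fin n × Fin n)) :
    S.card = ∑ k : Fin n, (univ.filter fun p : Fin n × Fin n => (k, p.1, p.2) ∈ S).card := by
  rw [Finset.card_eq_sum_card_fiberwise (f := fun p => p.1) (t := univ)
    (fun _ _ => Finset.mem_coe.2 (Finset.mem_univ _))]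
  refine Finset.sum_congr rfl fun k _ => ?_
  refine Finset.card_bij (fun p _ => p.2) ?_ ?_ ?_
  · rintro ⟨a, b, d⟩ h
    simp only [Finset.mem_filter, Finset.mem_univ, true_and] at h ⊢
    obtain ⟨h1, rfl⟩ := h
    exact h1
  · rintro ⟨a, b, d⟩ h ⟨a', b', d'⟩ h' he
    simp only [Finset.mem_filter] at h h' he
    rw [Prod.mk.injEq]
    exact ⟨h.2.trans h'.2.symm, he⟩
  · rintro ⟨b, d⟩ h
    simp only [Finset.mem_filter, Finset.mem_univ, true_and] at h
    exact ⟨(k, b, d), by simpa using h, rfl⟩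

theorem aux_sum_g {n : ℕ} (S : Finset (Fin n × Fin n × Fin n)) (E : Fin n → Finset (Fin n × Fin n))
    (hsub : ∀ k : Fin n, E k ⊆ univ.filter fun p : Fin n × Fin n => (k, p.1, p.2) ∈ S)
    (L : LatinSquare n) : ∑ k, gE (E k) (L.1 k) ≤ fE S L := by
  unfold fE
  rw [aux_card_rows]
  refine Finset.sum_le_sum fun k _ => ?_
  unfold gE
  refine Finset.card_le_card_of_injOn (fun i => (k, i)) ?_ ?_
  · intro i hi
    have hi' : (i, L.1 k i) ∈ E k := by simpa using hi
    have := hsub k hi'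
    simpa using this
  · intro a _ b _ h
    simpa using h

/-- **Claim.** Let `0 < c ≤ 1`, `γ = c/4`, and `𝓔 ⊆ T_n(2)` with `|𝓔| ≥ c·n³`.  For
`1 ≤ k ≤ n` let `E_k' = {(i,j) : [a_k,b_i,c_j] ∈ 𝓔}` and let `E_k ⊆ E_k'` be obtained
by shrinking each row of `E_k'` to an arbitrary subset of size `min(⌊n/2⌋, |row|)`.
Then for every Latin square `L = (π_1,…,π_n)` with `f_𝓔(L) < 10⁻³·c²·n²`, there is
`I_L ⊆ [n]` with `|I_L| ≥ γn/2` such that `|E_i| ≥ γ·n²` and `g_{E_i}(π_i) ≤ γn/10`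
for every `i ∈ I_L`. -/
theorem exists_bad_index_set (n : ℕ) (c : ℝ) (hc0 : 0 < c) (hc1 : c ≤ 1)
    (𝓔 : Finset (Fin n × Fin n × Fin n)) (h𝓔 : c * (n : ℝ) ^ 3 ≤ (𝓔.card : ℝ))
    (E : Fin n → Finset (Fin n × Fin n))
    (hsub : ∀ k : Fin n, E k ⊆ univ.filter fun p : Fin n × Fin n => (k, p.1, p.2) ∈ 𝓔)
    (hrow : ∀ k i : Fin n,
      ((E k).filter fun p => p.1 = i).card =
        min (n / 2)
          (((univ.filter fun p : Fin n × Fin n => (k, p.1, p.2) ∈ 𝓔).filter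
              fun p => p.1 = i).card)) :
    ∀ L : LatinSquare n, (fE 𝓔 L : ℝ) < (10 : ℝ) ^ (-(3 : ℤ)) * c ^ 2 * (n : ℝ) ^ 2 →
      ∃ I : Finset (Fin n), (c / 4) * (n : ℝ) / 2 ≤ (I.card : ℝ) ∧
        ∀ i ∈ I, (c / 4) * (n : ℝ) ^ 2 ≤ ((E i).card : ℝ) ∧
          (gE (E i) (L.1 i) : ℝ) ≤ (c / 4) * (n : ℝ) / 10 := by
  intro L hL
  rcases Nat.eq_zero_or_pos n with rfl | hn
  · exact ⟨∅, by simp, by simp⟩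
  rcases Nat.lt_or_ge n 2 with h2 | h2
  · exfalso
    obtain rfl : n = 1 := by omega
    have hpos : (0 : ℝ) < 𝓔.card := by
      refine lt_of_lt_of_le ?_ h𝓔
      simpa using hc0
    have hpos' : 0 < 𝓔.card := by exact_mod_cast hpos
    obtain ⟨x, hx⟩ := Finset.card_pos.1 hpos'
    have h1 : 1 ≤ fE 𝓔 L := by
      unfold fE
      refine Finset.card_pos.2 ⟨(0, 0), ?_⟩
      simp only [Finset.mem_filter, Finset.mem_univ, true_and]
      convert hx
    have h1' : (1 : ℝ) ≤ fE 𝓔 L := by exact_mod_cast h1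
    norm_num at hL
    nlinarith
  have hnR : (0 : ℝ) < n := by exact_mod_cast hn
  set h : ℕ := n / 2 with hh
  have h3 : n ≤ 3 * h := by omega
  have hle : h ≤ n := by omega
  have h3R : (n : ℝ) ≤ 3 * h := by exact_mod_cast h3
  have hhR : (0 : ℝ) < h := by linarith
  -- upper bound
  have hup : ∀ k, (E k).card ≤ n * h := by
    intro k
    rw [aux_card_rows (E k)]
    calc _ ≤ ∑ _i : Fin n, h := Finset.sum_le_sum fun i _ => by
            rw [hrow]; exact min_le_left _ _
      _ = n * h := by simp
  -- lower bound
  have hlow : h * 𝓔.card ≤ n * ∑ k, (E k).card := by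
    rw [aux_card_triples 𝓔, Finset.mul_sum, Finset.mul_sum]
    refine Finset.sum_le_sum fun k _ => ?_
    rw [aux_card_rows (E k), aux_card_rows (univ.filter _), Finset.mul_sum, Finset.mul_sum]
    refine Finset.sum_le_sum fun i _ => ?_
    rw [hrow]
    have hr : (((univ.filter fun p : Fin n × Fin n => (k, p.1, p.2) ∈ 𝓔).filter
              fun p => p.1 = i).card) ≤ n := by
      refine (Finset.card_le_card_of_injOn (t := (univ : Finset (Fin n))) (fun p => p.2)
        (fun _ _ => Finset.mem_coe.2 (Finset.mem_univ _)) ?_).trans (by simp)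
      intro a ha b hb hab
      have ha' := (Finset.mem_filter.1 (Finset.mem_coe.1 ha)).2
      have hb' := (Finset.mem_filter.1 (Finset.mem_coe.1 hb)).2
      exact Prod.ext (ha'.trans hb'.symm) hab
    generalize (((univ.filter fun p : Fin n × Fin n => (k, p.1, p.2) ∈ 𝓔).filter
              fun p => p.1 = i).card) = r at hr
    rcases min_choice h r with hm | hm <;> rw [hm]
    · rw [mul_comm]; exact Nat.mul_le_mul_right _ hr
    · exact Nat.mul_le_mul_right _ hle
  have hlowR : (h : ℝ) * 𝓔.card ≤ n * ∑ k, ((E k).card : ℝ) := by exact_mod_cast hlow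
  set A : Finset (Fin n) := univ.filter fun k => (c / 4) * (n : ℝ) ^ 2 ≤ ((E k).card : ℝ) with hA
  set B : Finset (Fin n) := univ.filter fun k =>
    (c / 4) * (n : ℝ) / 10 < (gE (E k) (L.1 k) : ℝ) with hB
  have hsumA : ∑ k, ((E k).card : ℝ) ≤ A.card * (n * h) + n * ((c / 4) * (n : ℝ) ^ 2) := by
    calc ∑ k, ((E k).card : ℝ)
        ≤ ∑ k : Fin n, ((if (c / 4) * (n : ℝ) ^ 2 ≤ ((E k).card : ℝ) then (n * h : ℝ) else 0)
            + (c / 4) * (n : ℝ) ^ 2) := by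
          refine Finset.sum_le_sum fun k _ => ?_
          have h1 : ((E k).card : ℝ) ≤ n * h := by exact_mod_cast hup k
          have h0 : 0 ≤ (c / 4) * (n : ℝ) ^ 2 := by positivity
          split_ifs with hk
          · linarith
          · push Not at hk
            linarith
      _ = _ := by
          rw [Finset.sum_add_distrib, ← Finset.sum_filter, ← hA]
          simp
  have hAc : c * n / 4 ≤ A.card := by
    have e1 : (h : ℝ) * (c * n ^ 3) ≤ n * (A.card * (n * h) + n * ((c / 4) * (n : ℝ) ^ 2)) :=
      (mul_le_mul_of_nonneg_left h𝓔 hhR.le).trans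
        (hlowR.trans (mul_le_mul_of_nonneg_left hsumA hnR.le))
    have e2 : (c * n ^ 3) * (n : ℝ) ≤ (c * n ^ 3) * (3 * h) :=
      mul_le_mul_of_nonneg_left h3R (by positivity)
    have e3 : (n ^ 2 * h : ℝ) * (c * n / 4) ≤ (n ^ 2 * h) * A.card := by nlinarith
    exact le_of_mul_le_mul_left e3 (by positivity)
  have hBc : (B.card : ℝ) ≤ c * n / 25 := by
    have e1 : (B.card : ℝ) * ((c / 4) * (n : ℝ) / 10) ≤ ∑ k, (gE (E k) (L.1 k) : ℝ) := by
      calc (B.card : ℝ) * ((c / 4) * (n : ℝ) / 10) = ∑ _k ∈ B, (c / 4) * (n : ℝ) / 10 := by simp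
        _ ≤ ∑ k ∈ B, (gE (E k) (L.1 k) : ℝ) :=
            Finset.sum_le_sum fun k hk => (Finset.mem_filter.1 hk).2.le
        _ ≤ _ := Finset.sum_le_sum_of_subset_of_nonneg (Finset.subset_univ _)
            fun _ _ _ => Nat.cast_nonneg _
    have e2 : ∑ k, (gE (E k) (L.1 k) : ℝ) ≤ fE 𝓔 L := by exact_mod_cast aux_sum_g 𝓔 E hsub L
    norm_num at hL
    have e3 : (c * n / 40 : ℝ) * B.card ≤ (c * n / 40) * (c * n / 25) := by nlinarith
    exact le_of_mul_le_mul_left e3 (by positivity)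
  have hAB : (A.card : ℝ) ≤ (A \ B).card + B.card := by
    exact_mod_cast Finset.card_le_card_sdiff_add_card
  refine ⟨A \ B, ?_, ?_⟩
  · have : 0 < c * n := by positivity
    linarith
  · intro i hi
    obtain ⟨h1, h2⟩ := Finset.mem_sdiff.1 hi
    refine ⟨(Finset.mem_filter.1 h1).2, ?_⟩
    by_contra hcon
    exact h2 (Finset.mem_filter.2 ⟨Finset.mem_univ _, not_le.1 hcon⟩)
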